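/- Suppose the finite simple graph G' is obtained from the finite simple graph G by a 3-dimensional vertex split. If there exists a placement q of G in Σ such that the framework (G,q) is full in Σ and infinitesimally rigid, then there exists a placement q' of G' in Σ such that the framework (G',q') is full in Σ and infinitesimally rigid. -/

import Mathlib

open Matrix BigOperators

/-- The hypercylinder Σ in ℝ⁴. -/
def Hyp : Set (Fin 4 → ℝ) := {x | x 0 ^ 2 + x 1 ^ 2 + x 2 ^ 2 = 1}

/-- π(x)·π(y), where π : ℝ⁴ → ℝ³ drops the last coordinate. -/
def piDot (x y : Fin 4 → ℝ) : ℝ := x 0 * y 0 + x 1 * y 1 + x 2 * y 2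

/-- The Euclidean inner product on ℝ⁴. -/
def dot4 (x y : Fin 4 → ℝ) : ℝ := ∑ i, x i * y i

/-- The pair (B,c) determines an infinitesimal rigid motion η(x) = Bx + c of Σ. -/
def InTSigma (B : Matrix (Fin 4) (Fin 4) ℝ) (c : Fin 4 → ℝ) : Prop :=
  Bᵀ = -B ∧ ∀ x ∈ Hyp, piDot (B.mulVec x + c) x = 0

/-- m is an infinitesimal flex of the framework (G,q) in Σ. -/
def IsFlex {V : Type*} (G : SimpleGraph V) (q m : V → Fin 4 → ℝ) : Prop :=
  (∀ u v, G.Adj u v → dot4 (m u - m v) (q u - q v) = 0) ∧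
    (∀ v, piDot (m v) (q v) = 0)

/-- The framework (G,q) is full in Σ. -/
def Full {V : Type*} (G : SimpleGraph V) (q : V → Fin 4 → ℝ) : Prop :=
  ∀ (B : Matrix (Fin 4) (Fin 4) ℝ) (c : Fin 4 → ℝ), InTSigma B c →
    (∀ v, B.mulVec (q v) + c = 0) → B = 0 ∧ c = 0

/-- The framework (G,q) is infinitesimally rigid in Σ. -/
def InfRigid {V : Type*} (G : SimpleGraph V) (q : V → Fin 4 → ℝ) : Prop :=
  ∀ m : V → Fin 4 → ℝ, IsFlex G q m →
    ∃ (B : Matrix (Fin 4) (Fin 4) ℝ) (c : Fin 4 → ℝ), InTSigma B c ∧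
      ∀ v, m v = B.mulVec (q v) + c

open Filter Topology

lemma piDot_add_left (x y z : Fin 4 → ℝ) : piDot (x + y) z = piDot x z + piDot y z := by
  simp only [piDot, Pi.add_apply]; ring

lemma piDot_sub_left (x y z : Fin 4 → ℝ) : piDot (x - y) z = piDot x z - piDot y z := by
  simp only [piDot, Pi.sub_apply]; ring

lemma piDot_smul_left (r : ℝ) (x z : Fin 4 → ℝ) : piDot (r • x) z = r * piDot x z := by
  simp only [piDot, Pi.smul_apply, smul_eq_mul]; ring

lemma dot4_sub_left (x y z : Fin 4 → ℝ) : dot4 (x - y) z = dot4 x z - dot4 y z := by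
  simp [dot4, sub_mul, Finset.sum_sub_distrib]

lemma dot4_smul_left (r : ℝ) (x z : Fin 4 → ℝ) : dot4 (r • x) z = r * dot4 x z := by
  simp [dot4, Finset.mul_sum, mul_assoc]

lemma continuous_dot4 : Continuous fun p : (Fin 4 → ℝ) × (Fin 4 → ℝ) => dot4 p.1 p.2 := by
  unfold dot4; fun_prop

lemma continuous_piDot : Continuous fun p : (Fin 4 → ℝ) × (Fin 4 → ℝ) => piDot p.1 p.2 := by
  unfold piDot; fun_prop

lemma InTSigma.add {B B' : Matrix (Fin 4) (Fin 4) ℝ} {c c' : Fin 4 → ℝ}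
    (h : InTSigma B c) (h' : InTSigma B' c') : InTSigma (B + B') (c + c') := by
  refine ⟨by rw [transpose_add, h.1, h'.1, neg_add], fun x hx => ?_⟩
  rw [Matrix.add_mulVec, add_add_add_comm, piDot_add_left, h.2 x hx, h'.2 x hx, add_zero]

lemma InTSigma.smul {B : Matrix (Fin 4) (Fin 4) ℝ} {c : Fin 4 → ℝ} (r : ℝ)
    (h : InTSigma B c) : InTSigma (r • B) (r • c) := by
  refine ⟨by rw [transpose_smul, h.1, smul_neg], fun x hx => ?_⟩
  rw [Matrix.smul_mulVec, ← smul_add, piDot_smul_left, h.2 x hx, mul_zero]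

lemma inTSigma_zero : InTSigma 0 0 := by
  refine ⟨by simp, fun x _ => by simp [piDot]⟩

lemma InTSigma.entry_swap {B : Matrix (Fin 4) (Fin 4) ℝ} {c : Fin 4 → ℝ} (h : InTSigma B c)
    (i j : Fin 4) : B j i = -B i j :=
  congrFun (congrFun h.1 i) j

lemma InTSigma.entries_eq_zero {B : Matrix (Fin 4) (Fin 4) ℝ} {c : Fin 4 → ℝ}
    (h : InTSigma B c) :
    (B 0 3 = 0 ∧ B 1 3 = 0 ∧ B 2 3 = 0) ∧ c 0 = 0 ∧ c 1 = 0 ∧ c 2 = 0 := by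
  have d0 := h.entry_swap 0 0
  have d1 := h.entry_swap 1 1
  have d2 := h.entry_swap 2 2
  have e0 := h.2 ![1, 0, 0, 0] (by simp [Hyp])
  have e0' := h.2 ![1, 0, 0, 1] (by simp [Hyp])
  have e1 := h.2 ![0, 1, 0, 0] (by simp [Hyp])
  have e1' := h.2 ![0, 1, 0, 1] (by simp [Hyp])
  have e2 := h.2 ![0, 0, 1, 0] (by simp [Hyp])
  have e2' := h.2 ![0, 0, 1, 1] (by simp [Hyp])
  simp [piDot, Matrix.mulVec, dotProduct, Fin.sum_univ_four] at e0 e0' e1 e1' e2 e2'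
  refine ⟨⟨?_, ?_, ?_⟩, ?_, ?_, ?_⟩ <;> linarith

/-- The restrictions to the placement `q` of the infinitesimal rigid motions of Σ. -/
def trivialMotions {V : Type*} (q : V → Fin 4 → ℝ) : Submodule ℝ (V → Fin 4 → ℝ) where
  carrier := {m | ∃ (B : Matrix (Fin 4) (Fin 4) ℝ) (c : Fin 4 → ℝ), InTSigma B c ∧
    ∀ v, m v = B.mulVec (q v) + c}
  zero_mem' := ⟨0, 0, inTSigma_zero, fun v => by simp⟩
  add_mem' := by
    rintro m m' ⟨B, c, h, hm⟩ ⟨B', c', h', hm'⟩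
    exact ⟨B + B', c + c', h.add h', fun v => by
      rw [Pi.add_apply, hm, hm', Matrix.add_mulVec, add_add_add_comm]⟩
  smul_mem' := by
    rintro r m ⟨B, c, h, hm⟩
    exact ⟨r • B, r • c, h.smul r, fun v => by
      rw [Pi.smul_apply, hm, Matrix.smul_mulVec, smul_add]⟩

lemma isFlex_of_mem_trivialMotions {V : Type*} (G : SimpleGraph V) {q m : V → Fin 4 → ℝ}
    (hq : ∀ v, q v ∈ Hyp) (hm : m ∈ trivialMotions q) : IsFlex G q m := by
  obtain ⟨B, c, h, hm⟩ := hm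
  refine ⟨fun u v _ => ?_, fun v => by rw [hm]; exact h.2 _ (hq v)⟩
  rw [hm, hm, add_sub_add_right_eq_sub, ← Matrix.mulVec_sub]
  generalize q u - q v = x
  have := h.entry_swap
  simp only [dot4, Matrix.mulVec, dotProduct, Fin.sum_univ_four]
  linear_combination x 0 * x 0 / 2 * this 0 0 + x 1 * x 1 / 2 * this 1 1
    + x 2 * x 2 / 2 * this 2 2 + x 3 * x 3 / 2 * this 3 3 + x 0 * x 1 * this 0 1
    + x 0 * x 2 * this 0 2 + x 0 * x 3 * this 0 3 + x 1 * x 2 * this 1 2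
    + x 1 * x 3 * this 1 3 + x 2 * x 3 * this 2 3

lemma IsFlex.sub {V : Type*} {G : SimpleGraph V} {q m m' : V → Fin 4 → ℝ}
    (h : IsFlex G q m) (h' : IsFlex G q m') : IsFlex G q (m - m') := by
  refine ⟨fun u v huv => ?_, fun v => ?_⟩
  · rw [Pi.sub_apply, Pi.sub_apply, sub_sub_sub_comm, dot4_sub_left, h.1 u v huv,
      h'.1 u v huv, sub_zero]
  · rw [Pi.sub_apply, piDot_sub_left, h.2, h'.2, sub_zero]

lemma IsFlex.smul {V : Type*} {G : SimpleGraph V} {q m : V → Fin 4 → ℝ} (r : ℝ)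
    (h : IsFlex G q m) : IsFlex G q (r • m) := by
  refine ⟨fun u v huv => ?_, fun v => ?_⟩
  · rw [Pi.smul_apply, Pi.smul_apply, ← smul_sub, dot4_smul_left, h.1 u v huv, mul_zero]
  · rw [Pi.smul_apply, piDot_smul_left, h.2, mul_zero]

lemma isFlex_of_tendsto {V : Type*} {G : SimpleGraph V} {q m : ℕ → V → Fin 4 → ℝ}
    {q₀ m₀ : V → Fin 4 → ℝ} (hq : Tendsto q atTop (𝓝 q₀)) (hm : Tendsto m atTop (𝓝 m₀))
    (h : ∀ n, IsFlex G (q n) (m n)) : IsFlex G q₀ m₀ := by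
  rw [tendsto_pi_nhds] at hq hm
  refine ⟨fun u v huv => ?_, fun v => ?_⟩
  · have := (continuous_dot4.tendsto _).comp
      (((hm u).sub (hm v)).prodMk_nhds ((hq u).sub (hq v)))
    refine tendsto_nhds_unique this (tendsto_const_nhds.congr fun n => ?_)
    exact ((h n).1 u v huv).symm
  · have := (continuous_piDot.tendsto _).comp ((hm v).prodMk_nhds (hq v))
    refine tendsto_nhds_unique this (tendsto_const_nhds.congr fun n => ?_)
    exact ((h n).2 v).symm

/-- The Euclidean inner product on `(ℝ⁴)^V`. -/
def sumDot {V : Type*} [Fintype V] : LinearMap.BilinForm ℝ (V → Fin 4 → ℝ) :=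
  LinearMap.mk₂ ℝ (fun x y => ∑ v, ∑ i, x v i * y v i)
    (fun x y z => by simp [add_mul, Finset.sum_add_distrib])
    (fun r x y => by simp [Finset.mul_sum, mul_assoc])
    (fun x y z => by simp [mul_add, Finset.sum_add_distrib])
    (fun r x y => by simp [Finset.mul_sum, mul_left_comm])

lemma sumDot_apply {V : Type*} [Fintype V] (x y : V → Fin 4 → ℝ) :
    sumDot x y = ∑ v, ∑ i, x v i * y v i := rfl

lemma eq_zero_of_sumDot_self {V : Type*} [Fintype V] {x : V → Fin 4 → ℝ}
    (h : sumDot x x = 0) : x = 0 := by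
  rw [sumDot_apply, Finset.sum_eq_zero_iff_of_nonneg
    fun v _ => Finset.sum_nonneg fun i _ => mul_self_nonneg _] at h
  funext v i
  have := (Finset.sum_eq_zero_iff_of_nonneg fun i _ => mul_self_nonneg _).1
    (h v (Finset.mem_univ v)) i (Finset.mem_univ i)
  exact mul_self_eq_zero.1 this

lemma exists_sub_orthogonal {V : Type*} [Fintype V] (S : Submodule ℝ (V → Fin 4 → ℝ))
    (m : V → Fin 4 → ℝ) : ∃ t ∈ S, ∀ s ∈ S, sumDot s (m - t) = 0 := by
  have hrefl : (sumDot (V := V)).IsRefl := fun x y h => by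
    rw [sumDot_apply] at h ⊢
    simpa only [mul_comm] using h
  have hnd : (sumDot.restrict S).Nondegenerate := by
    refine ⟨fun x hx => ?_, fun x hx => ?_⟩ <;>
      exact Subtype.ext (eq_zero_of_sumDot_self (hx x))
  have := LinearMap.BilinForm.isCompl_orthogonal_of_restrict_nondegenerate hrefl hnd
  obtain ⟨t, ht, u, hu, rfl⟩ := Submodule.mem_sup.1
    (this.sup_eq_top ▸ Submodule.mem_top : m ∈ S ⊔ sumDot.orthogonal S)
  exact ⟨t, ht, fun s hs => by simpa using hu s hs⟩

/-- A placement for which some flex is nontrivial has a unit flex orthogonal to all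
trivial ones. -/
lemma exists_unit_orthogonal_flex {V : Type*} [Fintype V] {G : SimpleGraph V}
    {q : V → Fin 4 → ℝ} (hq : ∀ v, q v ∈ Hyp) (h : ¬ InfRigid G q) :
    ∃ m, IsFlex G q m ∧ ‖m‖ = 1 ∧ ∀ s ∈ trivialMotions q, sumDot s m = 0 := by
  unfold InfRigid at h
  push Not at h
  obtain ⟨m, hm, hnt⟩ := h
  obtain ⟨t, ht, hort⟩ := exists_sub_orthogonal (trivialMotions q) m
  have hne : m - t ≠ 0 := fun h0 => by
    rw [sub_eq_zero] at h0
    obtain ⟨B, c, hB, hBc⟩ := ht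
    obtain ⟨v, hv⟩ := hnt B c hB
    exact hv (h0 ▸ hBc v)
  refine ⟨‖m - t‖⁻¹ • (m - t), (hm.sub (isFlex_of_mem_trivialMotions G hq ht)).smul _,
    norm_smul_inv_norm hne, fun s hs => ?_⟩
  rw [map_smul, hort s hs, smul_zero]

/-- If all limits of flexes along `q n → q₀` are trivial at `q₀`, then `q n` is eventually
infinitesimally rigid. -/
lemma eventually_infRigid {V : Type*} [Fintype V] {G : SimpleGraph V}
    {q : ℕ → V → Fin 4 → ℝ} {q₀ : V → Fin 4 → ℝ} (hq : Tendsto q atTop (𝓝 q₀))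
    (hHyp : ∀ n v, q n v ∈ Hyp)
    (h : ∀ s : ℕ → ℕ, Tendsto s atTop atTop → ∀ (m : ℕ → V → Fin 4 → ℝ) (m₀ : V → Fin 4 → ℝ),
      (∀ k, IsFlex G (q (s k)) (m k)) → Tendsto m atTop (𝓝 m₀) → m₀ ∈ trivialMotions q₀) :
    ∀ᶠ n in atTop, InfRigid G (q n) := by
  by_contra hcon
  obtain ⟨s, hs, hns⟩ := extraction_of_frequently_atTop (not_eventually.1 hcon)
  choose m hflex hnorm hort using fun k => exists_unit_orthogonal_flex (hHyp (s k)) (hns k)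
  obtain ⟨m₀, hm₀, r, hr, hlim⟩ := (isCompact_sphere (0 : V → Fin 4 → ℝ) 1).tendsto_subseq
    (x := m) fun k => by simp [hnorm k]
  have hsr : Tendsto (s ∘ r) atTop atTop := hs.tendsto_atTop.comp hr.tendsto_atTop
  obtain ⟨B, c, hB, hBc⟩ := h (s ∘ r) hsr (m ∘ r) m₀ (fun k => hflex (r k)) hlim
  have hcont : Continuous fun p : (V → Fin 4 → ℝ) × (V → Fin 4 → ℝ) =>
      sumDot (fun v => B.mulVec (p.1 v) + c) p.2 := by
    simp only [sumDot_apply, Matrix.mulVec, dotProduct, Pi.add_apply]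
    fun_prop
  have hlim' := (hcont.tendsto _).comp ((hq.comp hsr).prodMk_nhds hlim)
  have hzero : sumDot (fun v => B.mulVec (q₀ v) + c) m₀ = 0 := by
    refine tendsto_nhds_unique hlim' (tendsto_const_nhds.congr fun k => ?_)
    exact (hort (r k) _ ⟨B, c, hB, fun v => rfl⟩).symm
  rw [← funext hBc] at hzero
  simp [eq_zero_of_sumDot_self hzero] at hm₀

/-- A single vertex can be moved off a given plane through the axis of Σ
while keeping infinitesimal rigidity. -/
lemma exists_infRigid_update {V : Type*} [Fintype V] [DecidableEq V] {G : SimpleGraph V}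
    {q : V → Fin 4 → ℝ} (hq : ∀ v, q v ∈ Hyp) (hr : InfRigid G q) (w : V) {a : Fin 4 → ℝ}
    (ha : piDot a a ≠ 0) :
    ∃ y ∈ Hyp, InfRigid G (Function.update q w y) ∧ piDot a y ≠ 0 := by
  by_cases haw : piDot a (q w) = 0
  swap
  · exact ⟨q w, hq w, by rwa [Function.update_eq_self], haw⟩
  have hpos : 0 ≤ piDot a a := by
    simp only [piDot, ← sq]; positivity
  let N : ℝ → ℝ := fun t => √(1 + t ^ 2 * piDot a a)
  have hN : ∀ t, 0 < N t := fun t => Real.sqrt_pos.2 (by positivity)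
  have hN2 : ∀ t, N t ^ 2 = 1 + t ^ 2 * piDot a a := fun t => Real.sq_sqrt (by positivity)
  let y : ℝ → Fin 4 → ℝ := fun t =>
    ![(q w 0 + t * a 0) / N t, (q w 1 + t * a 1) / N t, (q w 2 + t * a 2) / N t, q w 3]
  have hqw : q w 0 ^ 2 + q w 1 ^ 2 + q w 2 ^ 2 = 1 := hq w
  have hy : ∀ t, y t ∈ Hyp := fun t => by
    have h1 := hN2 t
    have h2 := (hN t).ne'
    simp only [piDot] at h1 haw
    simp only [Hyp, y, Set.mem_ofPred_eq, cons_val]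
    field_simp
    linear_combination hqw + 2 * t * haw - h1
  have hya : ∀ t, t ≠ 0 → piDot a (y t) ≠ 0 := fun t ht => by
    have : piDot a (y t) = t * piDot a a / N t := by
      have h2 := (hN t).ne'
      simp only [piDot] at haw
      simp only [piDot, y, cons_val]
      field_simp
      linear_combination haw
    rw [this]
    exact div_ne_zero (mul_ne_zero ht ha) (hN t).ne'
  have hy0 : y 0 = q w := by
    funext i
    fin_cases i <;> simp [y, N]
  have hycont : Continuous y := by
    have hNc : Continuous N := by fun_prop
    refine continuous_pi fun i => ?_
    have hN' : ∀ t, N t ≠ 0 := fun t => (hN t).ne'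
    fin_cases i <;> simp [y] <;> fun_prop (disch := exact hN')
  have hlim : Tendsto (fun n : ℕ => Function.update q w (y (1 / ((n : ℝ) + 1)))) atTop (𝓝 q) := by
    have h1 : Continuous fun t => Function.update q w (y t) :=
      continuous_const.update w hycont
    have h2 := (h1.tendsto 0).comp tendsto_one_div_add_atTop_nhds_zero_nat
    rwa [hy0, Function.update_eq_self] at h2
  obtain ⟨n, hn⟩ := (eventually_infRigid (G := G) hlim (fun n v => by
      obtain rfl | hv := eq_or_ne v w
      · rw [Function.update_self]; exact hy _
      · rw [Function.update_of_ne hv]; exact hq v)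
    fun s hs m m₀ hm hm₀ => hr m₀ (isFlex_of_tendsto (hlim.comp hs) hm₀ hm)).exists
  exact ⟨_, hy _, hn, hya _ (by positivity)⟩

/-- The determinant of the projections of three points to ℝ³. -/
def piDet (x y z : Fin 4 → ℝ) : ℝ :=
  (x 1 * y 2 - x 2 * y 1) * z 0 + (x 2 * y 0 - x 0 * y 2) * z 1 + (x 0 * y 1 - x 1 * y 0) * z 2

lemma eq_zero_of_piDet_ne_zero {x y z : Fin 4 → ℝ} (h : piDet x y z ≠ 0) {a : Fin 4 → ℝ}
    (hx : piDot a x = 0) (hy : piDot a y = 0) (hz : piDot a z = 0) :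
    a 0 = 0 ∧ a 1 = 0 ∧ a 2 = 0 := by
  simp only [piDot] at hx hy hz
  refine ⟨?_, ?_, ?_⟩ <;> refine (mul_eq_zero.1 ?_).resolve_left h <;> unfold piDet
  · linear_combination (y 1 * z 2 - y 2 * z 1) * hx + (z 1 * x 2 - z 2 * x 1) * hy
      + (x 1 * y 2 - x 2 * y 1) * hz
  · linear_combination (y 2 * z 0 - y 0 * z 2) * hx + (z 2 * x 0 - z 0 * x 2) * hy
      + (x 2 * y 0 - x 0 * y 2) * hz
  · linear_combination (y 0 * z 1 - y 1 * z 0) * hx + (z 0 * x 1 - z 1 * x 0) * hy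
      + (x 0 * y 1 - x 1 * y 0) * hz

lemma exists_piDot_eq_zero (p : Fin 4 → ℝ) : ∃ a, piDot a a ≠ 0 ∧ piDot a p = 0 := by
  by_cases h : p 0 = 0
  · exact ⟨![1, 0, 0, 0], by simp [piDot], by simp [piDot, h]⟩
  · refine ⟨![-p 1, p 0, 0, 0], ?_, by simp [piDot]; ring⟩
    have : 0 < p 0 ^ 2 := by positivity
    simp only [piDot, cons_val]
    nlinarith [sq_nonneg (p 1)]

/-- Infinitesimal rigidity can be kept while making the projections of three distinct
vertices linearly independent. -/
lemma exists_infRigid_piDet_ne_zero {V : Type*} [Fintype V] [DecidableEq V]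
    {G : SimpleGraph V} {q : V → Fin 4 → ℝ} (hq : ∀ v, q v ∈ Hyp) (hr : InfRigid G q)
    {v₁ v₂ v₃ : V} (h12 : v₁ ≠ v₂) (h13 : v₁ ≠ v₃) (h23 : v₂ ≠ v₃) :
    ∃ p : V → Fin 4 → ℝ, (∀ v, p v ∈ Hyp) ∧ InfRigid G p ∧
      piDet (p v₁) (p v₂) (p v₃) ≠ 0 := by
  have hupd : ∀ {q : V → Fin 4 → ℝ} (w : V) {y : Fin 4 → ℝ}, (∀ v, q v ∈ Hyp) → y ∈ Hyp →
      ∀ v, Function.update q w y v ∈ Hyp := fun w y hq hy v => by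
    obtain rfl | hv := eq_or_ne v w
    · rwa [Function.update_self]
    · rw [Function.update_of_ne hv]; exact hq v
  obtain ⟨a, ha, hap⟩ := exists_piDot_eq_zero (q v₁)
  obtain ⟨y, hy, hry, hay⟩ := exists_infRigid_update hq hr v₂ ha
  let b : Fin 4 → ℝ := ![q v₁ 1 * y 2 - q v₁ 2 * y 1, q v₁ 2 * y 0 - q v₁ 0 * y 2,
    q v₁ 0 * y 1 - q v₁ 1 * y 0, 0]
  have hb : piDot b b ≠ 0 := fun h0 => by
    simp only [piDot, b, cons_val] at h0
    have h1 : q v₁ 1 * y 2 - q v₁ 2 * y 1 = 0 := by nlinarith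
    have h2 : q v₁ 2 * y 0 - q v₁ 0 * y 2 = 0 := by nlinarith
    have h3 : q v₁ 0 * y 1 - q v₁ 1 * y 0 = 0 := by nlinarith
    have hs : q v₁ 0 ^ 2 + q v₁ 1 ^ 2 + q v₁ 2 ^ 2 = 1 := hq v₁
    apply hay
    simp only [piDot] at hap ⊢
    linear_combination
      (q v₁ 0 * y 0 + q v₁ 1 * y 1 + q v₁ 2 * y 2) * hap
      - (a 0 * y 0 + a 1 * y 1 + a 2 * y 2) * hs
      + (a 2 * q v₁ 1 - a 1 * q v₁ 2) * h1 + (a 0 * q v₁ 2 - a 2 * q v₁ 0) * h2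
      + (a 1 * q v₁ 0 - a 0 * q v₁ 1) * h3
  obtain ⟨z, hz, hrz, hbz⟩ := exists_infRigid_update (hupd v₂ hq hy) hry v₃ hb
  refine ⟨_, hupd v₃ (hupd v₂ hq hy) hz, hrz, ?_⟩
  rw [Function.update_of_ne h13, Function.update_of_ne h12, Function.update_of_ne h23,
    Function.update_self, Function.update_self]
  simpa only [piDet, piDot, b, cons_val] using hbz

lemma full_of_piDet_ne_zero {V : Type*} (G : SimpleGraph V) {q : V → Fin 4 → ℝ}
    {v₁ v₂ v₃ : V} (h : piDet (q v₁) (q v₂) (q v₃) ≠ 0) : Full G q := by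
  intro B c hB hBc
  obtain ⟨⟨h03, h13, h23⟩, hc0, hc1, hc2⟩ := hB.entries_eq_zero
  have hrow : ∀ i, B i 3 = 0 → c i = 0 → B i 0 = 0 ∧ B i 1 = 0 ∧ B i 2 = 0 := by
    intro i hi hci
    have key : ∀ v, piDot (B i) (q v) = 0 := fun v => by
      have := congrFun (hBc v) i
      simp only [Matrix.mulVec, dotProduct, Fin.sum_univ_four, Pi.add_apply, Pi.zero_apply,
        hi, hci] at this
      simp only [piDot]
      linarith
    exact eq_zero_of_piDet_ne_zero h (key v₁) (key v₂) (key v₃)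
  have h30 := hB.entry_swap 0 3
  have h31 := hB.entry_swap 1 3
  have h32 := hB.entry_swap 2 3
  have h33 : B 3 3 = 0 := by linarith [hB.entry_swap 3 3]
  have hc3 : c 3 = 0 := by
    have := congrFun (hBc v₁) 3
    simpa [Matrix.mulVec, dotProduct, Fin.sum_univ_four, h30, h31, h32, h33, h03, h13, h23]
      using this
  have hr0 := hrow 0 h03 hc0
  have hr1 := hrow 1 h13 hc1
  have hr2 := hrow 2 h23 hc2
  have hr3 := hrow 3 h33 hc3
  constructor
  · ext i j
    fin_cases i <;> fin_cases j <;> simp_all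
  · funext i
    fin_cases i <;> assumption

/-- G', a graph on `Option V` whose new vertex is `none` (playing the role of v₀), is
obtained from G by a 3-dimensional vertex split at v₁ on the edges v₁v₂ and v₁v₃:
F is the set of neighbours x of v₁ (other than v₂, v₃) for which the edge v₁x is
replaced by the edge v₀x; the edges v₀v₁, v₀v₂, v₀v₃ are added. -/
theorem stmt8 {V : Type*} [Fintype V] [DecidableEq V]
    (G : SimpleGraph V) (v₁ v₂ v₃ : V)
    (h12 : G.Adj v₁ v₂) (h13 : G.Adj v₁ v₃) (h23 : v₂ ≠ v₃)
    (F : Set V) (hF : ∀ x ∈ F, G.Adj v₁ x) (hF2 : v₂ ∉ F) (hF3 : v₃ ∉ F)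
    (G' : SimpleGraph (Option V))
    (hsome : ∀ a b : V, G'.Adj (some a) (some b) ↔
      (G.Adj a b ∧ ¬((a = v₁ ∧ b ∈ F) ∨ (b = v₁ ∧ a ∈ F))))
    (hnone : ∀ x : V, G'.Adj none (some x) ↔ (x = v₁ ∨ x = v₂ ∨ x = v₃ ∨ x ∈ F))
    (hq : ∃ q : V → Fin 4 → ℝ, (∀ v, q v ∈ Hyp) ∧ Full G q ∧ InfRigid G q) :
    ∃ q' : Option V → Fin 4 → ℝ, (∀ v, q' v ∈ Hyp) ∧ Full G' q' ∧ InfRigid G' q' := by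
  obtain ⟨q₀, hq₀, -, hr₀⟩ := hq
  obtain ⟨q, hqH, hr, hdet⟩ := exists_infRigid_piDet_ne_zero hq₀ hr₀ h12.ne h13.ne h23
  let y : ℝ → Fin 4 → ℝ := fun t => ![q v₁ 0, q v₁ 1, q v₁ 2, q v₁ 3 + t]
  have hy0 : y 0 = q v₁ := by
    funext i
    fin_cases i <;> simp [y]
  let p : ℝ → Option V → Fin 4 → ℝ := fun t o => o.elim (y t) q
  have hpcont : Continuous p := by
    refine continuous_pi fun o => ?_
    cases o with
    | none =>
      refine continuous_pi fun i => ?_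
      fin_cases i <;> simp [p, y] <;> fun_prop
    | some v => exact continuous_const
  let t : ℕ → ℝ := fun n => 1 / ((n : ℝ) + 1)
  have ht : Tendsto t atTop (𝓝 0) := tendsto_one_div_add_atTop_nhds_zero_nat
  have hlim : Tendsto (fun n => p (t n)) atTop (𝓝 (p 0)) := (hpcont.tendsto 0).comp ht
  have hpH : ∀ n v, p (t n) v ∈ Hyp := by
    intro n v
    cases v with
    | none => exact hqH v₁
    | some v => exact hqH v
  have hv₁F : v₁ ∉ F := fun h => (hF v₁ h).ne rfl
  have hadj : ∀ b, G.Adj v₁ b → b ∉ F → G'.Adj (some v₁) (some b) := fun b hb hbF =>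
    (hsome v₁ b).2 ⟨hb, by tauto⟩
  have hlimits : ∀ s : ℕ → ℕ, Tendsto s atTop atTop →
      ∀ (m : ℕ → Option V → Fin 4 → ℝ) (m₀ : Option V → Fin 4 → ℝ),
      (∀ k, IsFlex G' (p (t (s k))) (m k)) → Tendsto m atTop (𝓝 m₀) →
      m₀ ∈ trivialMotions (p 0) := by
    intro s hs m m₀ hm hm₀
    have hflex : IsFlex G' (p 0) m₀ := isFlex_of_tendsto (hlim.comp hs) hm₀ hm
    have hvert : m₀ none 3 - m₀ (some v₁) 3 = 0 := by
      rw [tendsto_pi_nhds] at hm₀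
      have h1 := (tendsto_pi_nhds.1 (hm₀ none) 3).sub (tendsto_pi_nhds.1 (hm₀ (some v₁)) 3)
      refine tendsto_nhds_unique h1 (tendsto_const_nhds.congr fun k => ?_)
      have h2 := (hm k).1 none (some v₁) ((hnone v₁).2 (Or.inl rfl))
      have h3 : t (s k) ≠ 0 := by positivity
      simp [dot4, Fin.sum_univ_four, p, y, h3] at h2
      exact h2.symm
    have hpi : ∀ b, G.Adj v₁ b → b ∉ F → G'.Adj none (some b) →
        piDot (m₀ none - m₀ (some v₁)) (q v₁) = 0 →
        piDot (m₀ none - m₀ (some v₁)) (q b) = 0 := by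
      intro b hb hbF hb' h0
      have h1 := hflex.1 _ _ hb'
      have h2 := hflex.1 _ _ (hadj b hb hbF)
      simp only [p, Option.elim, hy0, dot4, Fin.sum_univ_four, Pi.sub_apply] at h1 h2
      simp only [piDot, Pi.sub_apply] at h0 ⊢
      linear_combination h2 - h1 + h0 + (q v₁ 3 - q b 3) * hvert
    have hp₁ : piDot (m₀ none - m₀ (some v₁)) (q v₁) = 0 := by
      have h1 := hflex.2 none
      have h2 := hflex.2 (some v₁)
      simp only [p, Option.elim, hy0] at h1 h2
      rw [piDot_sub_left, h1, h2, sub_zero]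
    obtain ⟨e0, e1, e2⟩ := eq_zero_of_piDet_ne_zero hdet hp₁
      (hpi v₂ h12 hF2 ((hnone v₂).2 (by tauto)) hp₁)
      (hpi v₃ h13 hF3 ((hnone v₃).2 (by tauto)) hp₁)
    have hm01 : m₀ none = m₀ (some v₁) := by
      rw [← sub_eq_zero]
      funext i
      fin_cases i <;> assumption
    have hF' : ∀ b ∈ F, dot4 (m₀ (some v₁) - m₀ (some b)) (q v₁ - q b) = 0 := fun b hb => by
      have := hflex.1 none (some b) ((hnone b).2 (by tauto))
      simpa only [p, Option.elim, hy0, hm01] using this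
    obtain ⟨B, c, hB, hBc⟩ := hr (fun v => m₀ (some v)) ⟨fun u v huv => by
      by_cases hu : u = v₁ ∧ v ∈ F
      · obtain ⟨rfl, hv⟩ := hu
        exact hF' v hv
      by_cases hv : v = v₁ ∧ u ∈ F
      · obtain ⟨rfl, huF⟩ := hv
        have := hF' u huF
        rw [← neg_sub (m₀ (some u)), ← neg_sub (q u)] at this
        simpa only [dot4, Pi.neg_apply, neg_mul_neg] using this
      exact hflex.1 (some u) (some v) ((hsome u v).2 ⟨huv, by tauto⟩),
      fun v => hflex.2 (some v)⟩
    refine ⟨B, c, hB, fun o => ?_⟩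
    cases o with
    | none => rw [hm01]; simpa only [p, Option.elim, hy0] using hBc v₁
    | some v => exact hBc v
  obtain ⟨n, hn⟩ := (eventually_infRigid hlim hpH hlimits).exists
  exact ⟨p (t n), hpH n, full_of_piDet_ne_zero G'
    (v₁ := some v₁) (v₂ := some v₂) (v₃ := some v₃) hdet, hn⟩
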